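/- Let K be a field of characteristic two and let A = Q(3A)_2^2 be the algebra of quaternion type given by the stated quiver and relations. Then A is a symmetric algebra: there exists a K-linear map λ: A → K with λ(ab) = λ(ba) for all a,b ∈ A whose kernel contains no nonzero right ideal of A. -/

import Mathlib

universe u

/-- The generators of the quiver of the algebra `Q(3A)₂²`: three vertex idempotents
`v1, v2, v3` and four arrows `ab : 1 → 2`, `ay : 2 → 1`, `ad : 2 → 3`, `an : 3 → 2`
(named `b`, `y`, `d`, `n` in the informal description). -/
inductive QGen : Type
  | v1 | v2 | v3 | ab | ay | ad | an

open QGen FreeAlgebra in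
/-- The defining relations presenting the algebra of quaternion type `Q(3A)₂²` as a quotient
of the free algebra on the vertices and arrows of the quiver: the vertex idempotents are
pairwise orthogonal idempotents summing to `1`, the arrows have the prescribed sources and
targets, and the relations `byb = bdnybdn`, `yby = dnybdny`, `ndn = nybdnyb`,
`dnd = ybdnybd`, `bybd = 0`, `ndny = 0` hold (paths are composed from left to right). -/
inductive QuatRel (K : Type u) [CommRing K] : FreeAlgebra K QGen → FreeAlgebra K QGen → Prop
  | idem1 : QuatRel K (ι K v1 * ι K v1) (ι K v1)
  | idem2 : QuatRel K (ι K v2 * ι K v2) (ι K v2)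
  | idem3 : QuatRel K (ι K v3 * ι K v3) (ι K v3)
  | orth12 : QuatRel K (ι K v1 * ι K v2) 0
  | orth21 : QuatRel K (ι K v2 * ι K v1) 0
  | orth13 : QuatRel K (ι K v1 * ι K v3) 0
  | orth31 : QuatRel K (ι K v3 * ι K v1) 0
  | orth23 : QuatRel K (ι K v2 * ι K v3) 0
  | orth32 : QuatRel K (ι K v3 * ι K v2) 0
  | unit : QuatRel K (ι K v1 + ι K v2 + ι K v3) 1
  | src_b : QuatRel K (ι K v1 * ι K ab) (ι K ab)
  | tgt_b : QuatRel K (ι K ab * ι K v2) (ι K ab)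
  | src_y : QuatRel K (ι K v2 * ι K ay) (ι K ay)
  | tgt_y : QuatRel K (ι K ay * ι K v1) (ι K ay)
  | src_d : QuatRel K (ι K v2 * ι K ad) (ι K ad)
  | tgt_d : QuatRel K (ι K ad * ι K v3) (ι K ad)
  | src_n : QuatRel K (ι K v3 * ι K an) (ι K an)
  | tgt_n : QuatRel K (ι K an * ι K v2) (ι K an)
  | rel1 : QuatRel K (ι K ab * ι K ay * ι K ab)
      (ι K ab * ι K ad * ι K an * ι K ay * ι K ab * ι K ad * ι K an)
  | rel2 : QuatRel K (ι K ay * ι K ab * ι K ay)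
      (ι K ad * ι K an * ι K ay * ι K ab * ι K ad * ι K an * ι K ay)
  | rel3 : QuatRel K (ι K an * ι K ad * ι K an)
      (ι K an * ι K ay * ι K ab * ι K ad * ι K an * ι K ay * ι K ab)
  | rel4 : QuatRel K (ι K ad * ι K an * ι K ad)
      (ι K ay * ι K ab * ι K ad * ι K an * ι K ay * ι K ab * ι K ad)
  | rel5 : QuatRel K (ι K ab * ι K ay * ι K ab * ι K ad) 0
  | rel6 : QuatRel K (ι K an * ι K ad * ι K an * ι K ay) 0

/-- The algebra of quaternion type `Q(3A)₂²` over `K`: the path algebra of the quiver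
modulo the admissible ideal, presented by generators and relations. -/
abbrev QuatAlg (K : Type u) [CommRing K] : Type u := RingQuot (QuatRel K)

/-- The images of the vertex idempotents and arrows in the algebra `Q(3A)₂²`. -/
noncomputable def qgen (K : Type u) [CommRing K] (x : QGen) : QuatAlg K :=
  RingQuot.mkAlgHom K (QuatRel K) (FreeAlgebra.ι K x)

namespace QuatAlg

section Combinatorics

open QGen

/-- The source of an arrow; a vertex is its own source. -/
def source : QGen → Fin 3
  | v1 | ab => 0
  | v2 | ay | ad => 1
  | v3 | an => 2

/-- The target of an arrow; a vertex is its own target. -/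
def target : QGen → Fin 3
  | v1 | ay => 0
  | v2 | ab | an => 1
  | v3 | ad => 2

/-- The vertices of the quiver. -/
def vertex : Fin 3 → QGen := ![v1, v2, v3]

/-- The nonzero paths of `Q(3A)₂²` in normal form; they form a basis. -/
def basisWord : Fin 36 → List QGen :=
  ![
    [v1], [v2], [v3], [ab], [ay], [ad], [an], [ab, ay], [ab, ad], [ay, ab], [ad, an],
    [an, ay], [an, ad], [ab, ay, ab], [ab, ad, an], [ay, ab, ay], [ay, ab, ad],
    [ad, an, ay], [ad, an, ad], [an, ay, ab], [an, ad, an], [ab, ay, ab, ay],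
    [ab, ad, an, ay], [ay, ab, ay, ab], [ay, ab, ad, an], [ad, an, ay, ab],
    [an, ay, ab, ad], [an, ad, an, ad], [ab, ad, an, ay, ab], [ay, ab, ad, an, ay],
    [ad, an, ay, ab, ad], [an, ay, ab, ad, an], [ab, ad, an, ay, ab, ad],
    [ay, ab, ad, an, ay, ab], [ad, an, ay, ab, ad, an], [an, ay, ab, ad, an, ay]]

/-- Left multiplication by a generator on the basis paths, `none` standing for zero. -/
def arrowAct : QGen → Fin 36 → Option (Fin 36)
  | v1 => ![
    some 0, none, none, some 3, none, none, none, some 7, some 8, none, none, none, none,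
    some 13, some 14, none, none, none, none, none, none, some 21, some 22, none, none,
    none, none, none, some 28, none, none, none, some 32, none, none, none]
  | v2 => ![
    none, some 1, none, none, some 4, some 5, none, none, none, some 9, some 10, none, none,
    none, none, some 15, some 16, some 17, some 18, none, none, none, none, some 23, some 24,
    some 25, none, none, none, some 29, some 30, none, none, some 33, some 34, none]
  | v3 => ![
    none, none, some 2, none, none, none, some 6, none, none, none, none, some 11, some 12,
    none, none, none, none, none, none, some 19, some 20, none, none, none, none, none, some 26,
    some 27, none, none, none, some 31, none, none, none, some 35]
  | ab => ![
    none, some 3, none, none, some 7, some 8, none, none, none, some 13, some 14, none,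
    none, none, none, some 21, none, some 22, none, none, none, none, none, none, none, some 28,
    none, none, none, none, some 32, none, none, none, some 13, none]
  | ay => ![
    some 4, none, none, some 9, none, none, none, some 15, some 16, none, none, none, none,
    some 23, some 24, none, none, none, none, none, none, none, some 29, none, none, none,
    none, none, some 33, none, none, none, some 18, none, none, none]
  | ad => ![
    none, none, some 5, none, none, none, some 10, none, none, none, none, some 17, some 18,
    none, none, none, none, none, none, some 25, some 23, none, none, none, none, none, some 30,
    none, none, none, none, some 34, none, none, none, some 15]
  | an => ![
    none, some 6, none, none, some 11, some 12, none, none, none, some 19, some 20, none,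
    none, none, none, none, some 26, none, some 27, none, none, none, none, none, some 31,
    none, none, none, none, some 35, none, none, none, some 20, none, none]

/-- The dual basis of the symmetrizing form consists of the paths `dualPos i`, except for one
index at which the path `dualNeg i` has to be subtracted. -/
def dualPos : Fin 36 → Fin 36 :=
  ![
    21, 23, 27, 15, 13, 20, 18, 7, 35, 34, 33, 32, 12, 4, 29, 3, 31, 28, 6, 30, 5, 0, 22, 1,
    24, 25, 26, 2, 17, 14, 19, 16, 11, 10, 9, 8]

/-- The paths subtracted in the dual basis, see `dualPos`. -/
def dualNeg : Fin 36 → Option (Fin 36) :=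
  ![
    none, none, none, none, none, none, none, none, none, none, none, none, none, none,
    none, none, none, none, none, none, none, none, none, none, none, none, none, none,
    none, none, none, none, none, some 33, some 34, none]

/-- Left multiplication by a product of generators on the basis paths. -/
def wordAct (w : List QGen) (o : Option (Fin 36)) : Option (Fin 36) :=
  w.foldr (fun g o => o.bind (arrowAct g)) o

/-- The symmetrizing form on the basis paths: `1` on the socle paths and `0` elsewhere. -/
def pathTrace : Option (Fin 36) → ℤ
  | some 21 | some 23 | some 27 => 1
  | _ => 0

theorem wordAct_vertices (i : Fin 36) :
    (wordAct (basisWord i) (some 0), wordAct (basisWord i) (some 1),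
      wordAct (basisWord i) (some 2)) ∈
      [(some i, none, none), (none, some i, none), (none, none, some i)] := by
  revert i
  decide +kernel

theorem pathTrace_wordAct_comm (i j : Fin 36) :
    pathTrace (wordAct (basisWord i) (some j)) = pathTrace (wordAct (basisWord j) (some i)) := by
  revert i j
  decide +kernel

theorem pathTrace_wordAct_dual (i j : Fin 36) :
    pathTrace (wordAct (basisWord j) (some (dualPos i))) -
      pathTrace (wordAct (basisWord j) (dualNeg i)) = if j = i then 1 else 0 := by
  revert i j
  decide +kernel

end Combinatorics

section Relations

variable {K : Type u} [CommRing K]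

theorem mk_eq_of_rel {x y : FreeAlgebra K QGen} (h : QuatRel K x y) :
    RingQuot.mkAlgHom K (QuatRel K) x = RingQuot.mkAlgHom K (QuatRel K) y :=
  RingQuot.mkAlgHom_rel K h

theorem source_mul (g : QGen) : qgen K (vertex (source g)) * qgen K g = qgen K g := by
  simp only [qgen, ← map_mul]
  cases g <;> exact mk_eq_of_rel (by constructor)

theorem mul_target (g : QGen) : qgen K g * qgen K (vertex (target g)) = qgen K g := by
  simp only [qgen, ← map_mul]
  cases g <;> exact mk_eq_of_rel (by constructor)

theorem vertex_mul_vertex {i j : Fin 3} (h : i ≠ j) :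
    qgen K (vertex i) * qgen K (vertex j) = 0 := by
  rw [qgen, qgen, ← map_mul, ← map_zero (RingQuot.mkAlgHom K (QuatRel K))]
  fin_cases i <;> fin_cases j <;> first | exact absurd rfl h | exact mk_eq_of_rel (by constructor)

theorem mul_mul_eq_zero {g h : QGen} (hgh : target g ≠ source h) (t : QuatAlg K) :
    qgen K g * (qgen K h * t) = 0 := by
  rw [← mul_target g, ← source_mul h, mul_assoc, ← mul_assoc _ _ t, ← mul_assoc _ _ t,
    ← mul_assoc (qgen K (vertex _)), vertex_mul_vertex hgh]
  simp

theorem v1_mul {g : QGen} (h : source g = 0) (t : QuatAlg K) :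
    qgen K .v1 * (qgen K g * t) = qgen K g * t := by
  rw [← mul_assoc, show qgen K .v1 = qgen K (vertex (source g)) by rw [h]; rfl, source_mul]

theorem v2_mul {g : QGen} (h : source g = 1) (t : QuatAlg K) :
    qgen K .v2 * (qgen K g * t) = qgen K g * t := by
  rw [← mul_assoc, show qgen K .v2 = qgen K (vertex (source g)) by rw [h]; rfl, source_mul]

theorem v3_mul {g : QGen} (h : source g = 2) (t : QuatAlg K) :
    qgen K .v3 * (qgen K g * t) = qgen K g * t := by
  rw [← mul_assoc, show qgen K .v3 = qgen K (vertex (source g)) by rw [h]; rfl, source_mul]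

theorem mul_v1 {g : QGen} (h : target g = 0) (t : QuatAlg K) :
    qgen K g * (qgen K .v1 * t) = qgen K g * t := by
  rw [← mul_assoc, show qgen K .v1 = qgen K (vertex (target g)) by rw [h]; rfl, mul_target]

theorem mul_v2 {g : QGen} (h : target g = 1) (t : QuatAlg K) :
    qgen K g * (qgen K .v2 * t) = qgen K g * t := by
  rw [← mul_assoc, show qgen K .v2 = qgen K (vertex (target g)) by rw [h]; rfl, mul_target]

theorem mul_v3 {g : QGen} (h : target g = 2) (t : QuatAlg K) :
    qgen K g * (qgen K .v3 * t) = qgen K g * t := by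
  rw [← mul_assoc, show qgen K .v3 = qgen K (vertex (target g)) by rw [h]; rfl, mul_target]

local notation "b" => qgen K QGen.ab
local notation "y" => qgen K QGen.ay
local notation "d" => qgen K QGen.ad
local notation "n" => qgen K QGen.an

theorem bdnybdn_mul (t : QuatAlg K) :
    b * (d * (n * (y * (b * (d * (n * t)))))) = b * (y * (b * t)) := by
  simpa [qgen, mul_assoc] using congrArg (· * t) (mk_eq_of_rel (K := K) .rel1).symm

theorem dnybdny_mul (t : QuatAlg K) :
    d * (n * (y * (b * (d * (n * (y * t)))))) = y * (b * (y * t)) := by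
  simpa [qgen, mul_assoc] using congrArg (· * t) (mk_eq_of_rel (K := K) .rel2).symm

theorem nybdnyb_mul (t : QuatAlg K) :
    n * (y * (b * (d * (n * (y * (b * t)))))) = n * (d * (n * t)) := by
  simpa [qgen, mul_assoc] using congrArg (· * t) (mk_eq_of_rel (K := K) .rel3).symm

theorem ybdnybd_mul (t : QuatAlg K) :
    y * (b * (d * (n * (y * (b * (d * t)))))) = d * (n * (d * t)) := by
  simpa [qgen, mul_assoc] using congrArg (· * t) (mk_eq_of_rel (K := K) .rel4).symm

theorem bybd_mul (t : QuatAlg K) : b * (y * (b * (d * t))) = 0 := by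
  simpa [qgen, mul_assoc] using congrArg (· * t) (mk_eq_of_rel (K := K) .rel5)

theorem ndny_mul (t : QuatAlg K) : n * (d * (n * (y * t))) = 0 := by
  simpa [qgen, mul_assoc] using congrArg (· * t) (mk_eq_of_rel (K := K) .rel6)

theorem bdnd_mul (t : QuatAlg K) : b * (d * (n * (d * t))) = 0 := by
  rw [← ybdnybd_mul, bybd_mul]

theorem nyby_mul (t : QuatAlg K) : n * (y * (b * (y * t))) = 0 := by
  rw [← dnybdny_mul, ndny_mul]

theorem dndn_mul (t : QuatAlg K) : d * (n * (d * (n * t))) = y * (b * (y * (b * t))) := by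
  rw [← ybdnybd_mul, bdnybdn_mul]

theorem bybyb_mul (t : QuatAlg K) : b * (y * (b * (y * (b * t)))) = 0 := by
  rw [← dndn_mul, bdnd_mul]

theorem ybyby_mul (t : QuatAlg K) : y * (b * (y * (b * (y * t)))) = 0 := by
  rw [← dndn_mul, ndny_mul, mul_zero]

end Relations

section Basis

variable (K : Type u) [CommRing K]

/-- The basis path with a given index as an element of the algebra, `none` being sent to `0`. -/
noncomputable def path : Option (Fin 36) → QuatAlg K
  | none => 0
  | some i => ((basisWord i).map (qgen K)).prod

/-- The coordinate vector of a basis path, `none` being sent to `0`. -/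
noncomputable def coordVec : Option (Fin 36) → (Fin 36 →₀ K)
  | none => 0
  | some i => Finsupp.single i 1

/-- Left multiplication by a generator in coordinates. -/
noncomputable def genEnd (g : QGen) : Module.End K (Fin 36 →₀ K) :=
  Finsupp.linearCombination K fun i => coordVec K (arrowAct g i)

theorem genEnd_coordVec (g : QGen) (o : Option (Fin 36)) :
    genEnd K g (coordVec K o) = coordVec K (o.bind (arrowAct g)) := by
  cases o <;> simp [genEnd, coordVec]

theorem end_ext {f g : Module.End K (Fin 36 →₀ K)}
    (h : ∀ i, f (coordVec K (some i)) = g (coordVec K (some i))) : f = g :=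
  Finsupp.lhom_ext' fun i => LinearMap.ext_ring (h i)

/-- The regular representation of the algebra in coordinates. -/
noncomputable def regularRep : QuatAlg K →ₐ[K] Module.End K (Fin 36 →₀ K) :=
  RingQuot.liftAlgHom K ⟨FreeAlgebra.lift K (genEnd K), fun x z h => by
    refine end_ext K fun i => ?_
    cases h
    case unit => fin_cases i <;> simp [genEnd, arrowAct, coordVec]
    all_goals
      simp only [map_mul, map_zero, FreeAlgebra.lift_ι_apply, Module.End.mul_apply,
        genEnd_coordVec, LinearMap.zero_apply]
      first
        | refine congrArg (coordVec K) ?_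
        | refine congrArg (coordVec K) (?_ : _ = none)
      revert i
      decide +kernel⟩

theorem regularRep_qgen (g : QGen) : regularRep K (qgen K g) = genEnd K g := by
  simp [regularRep, qgen]

theorem regularRep_path_coordVec (i : Fin 36) (o : Option (Fin 36)) :
    regularRep K (path K (some i)) (coordVec K o) = coordVec K (wordAct (basisWord i) o) := by
  rw [path, wordAct]
  induction basisWord i with
  | nil => simp
  | cons g w ih => simp [ih, regularRep_qgen, genEnd_coordVec]

/-- The coordinates of the unit of the algebra. -/
noncomputable def oneVec : Fin 36 →₀ K :=
  coordVec K (some 0) + coordVec K (some 1) + coordVec K (some 2)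

theorem regularRep_path_oneVec (i : Fin 36) :
    regularRep K (path K (some i)) (oneVec K) = coordVec K (some i) := by
  have h := wordAct_vertices i
  simp only [List.mem_cons, Prod.mk.injEq, List.not_mem_nil, or_false] at h
  simp only [oneVec, map_add, regularRep_path_coordVec]
  rcases h with ⟨h₁, h₂, h₃⟩ | ⟨h₁, h₂, h₃⟩ | ⟨h₁, h₂, h₃⟩ <;> simp [h₁, h₂, h₃, coordVec]

/-- The element of the algebra with given coordinates. -/
noncomputable def ofCoords : (Fin 36 →₀ K) →ₗ[K] QuatAlg K :=
  Finsupp.linearCombination K fun i => path K (some i)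

theorem ofCoords_coordVec (o : Option (Fin 36)) : ofCoords K (coordVec K o) = path K o := by
  cases o <;> simp [ofCoords, coordVec, path]

theorem qgen_mul_path (g : QGen) (i : Fin 36) :
    qgen K g * path K (some i) = path K (arrowAct g i) := by
  cases g <;> fin_cases i <;>
    simp (disch := decide) [path, basisWord, arrowAct, -mul_one, mul_mul_eq_zero,
      v1_mul, v2_mul, v3_mul, mul_v1, mul_v2, mul_v3, bdnybdn_mul, dnybdny_mul, nybdnyb_mul,
      ybdnybd_mul, bybd_mul, ndny_mul, bdnd_mul, nyby_mul, dndn_mul, bybyb_mul, ybyby_mul]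

theorem ofCoords_regularRep (a : QuatAlg K) (v : Fin 36 →₀ K) :
    ofCoords K (regularRep K a v) = a * ofCoords K v := by
  obtain ⟨x, rfl⟩ := RingQuot.mkAlgHom_surjective K (QuatRel K) a
  induction x generalizing v with
  | grade0 r => simp [Algebra.algebraMap_eq_smul_one]
  | grade1 g =>
    change ofCoords K (regularRep K (qgen K g) v) = qgen K g * ofCoords K v
    rw [regularRep_qgen]
    induction v using Finsupp.induction_linear with
    | zero => simp
    | add v w hv hw => simp [hv, hw, mul_add]
    | single i c =>
      rw [← mul_one c, ← smul_eq_mul, ← Finsupp.smul_single]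
      change ofCoords K (genEnd K g (c • coordVec K (some i))) =
        qgen K g * ofCoords K (c • coordVec K (some i))
      simp [genEnd_coordVec, ofCoords_coordVec, qgen_mul_path]
  | mul x z hx hz => simp [hx, hz, mul_assoc]
  | add x z hx hz => simp [hx, hz, add_mul]

theorem ofCoords_oneVec : ofCoords K (oneVec K) = 1 := by
  have h := mk_eq_of_rel (K := K) .unit
  simpa [oneVec, ofCoords_coordVec, path, basisWord, qgen] using h

/-- The coordinates of an element with respect to the basis of paths. -/
noncomputable def coords : QuatAlg K →ₗ[K] (Fin 36 →₀ K) :=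
  LinearMap.applyₗ (oneVec K) ∘ₗ (regularRep K).toLinearMap

theorem coords_apply (a : QuatAlg K) : coords K a = regularRep K a (oneVec K) := rfl

theorem ofCoords_coords (a : QuatAlg K) : ofCoords K (coords K a) = a := by
  rw [coords_apply, ofCoords_regularRep, ofCoords_oneVec, mul_one]

theorem coords_path (o : Option (Fin 36)) : coords K (path K o) = coordVec K o := by
  cases o with
  | none => simp [path, coordVec]
  | some i => exact regularRep_path_oneVec K i

/-- The symmetrizing form of the algebra. -/
noncomputable def trace : QuatAlg K →ₗ[K] K :=
  Finsupp.linearCombination K (fun i => (pathTrace (some i) : K)) ∘ₗ coords K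

theorem trace_path (o : Option (Fin 36)) : trace K (path K o) = pathTrace o := by
  rw [trace, LinearMap.comp_apply, coords_path]
  cases o <;> simp [coordVec, pathTrace]

theorem path_mul_path (i : Fin 36) (o : Option (Fin 36)) :
    path K (some i) * path K o = path K (wordAct (basisWord i) o) := by
  rw [← ofCoords_coordVec K o, ← ofCoords_regularRep, regularRep_path_coordVec,
    ofCoords_coordVec]

variable {K} in
theorem induction_on_path {p : QuatAlg K → Prop} (zero : p 0)
    (add : ∀ a c, p a → p c → p (a + c)) (smul_path : ∀ (r : K) i, p (r • path K (some i)))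
    (a : QuatAlg K) : p a := by
  rw [← ofCoords_coords K a]
  induction coords K a using Finsupp.induction_linear with
  | zero => simpa using zero
  | add v w hv hw => simpa using add _ _ hv hw
  | single i r => simpa [ofCoords] using smul_path r i

theorem trace_mul_comm (a c : QuatAlg K) : trace K (a * c) = trace K (c * a) := by
  induction a using induction_on_path with
  | zero => simp
  | add a₁ a₂ h₁ h₂ => simp [add_mul, mul_add, h₁, h₂]
  | smul_path r i =>
    induction c using induction_on_path with
    | zero => simp
    | add c₁ c₂ h₁ h₂ => simp only [add_mul, mul_add, map_add, h₁, h₂]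
    | smul_path s j =>
      simp [path_mul_path, trace_path, pathTrace_wordAct_comm i j, mul_left_comm]

theorem trace_mul_dual (a : QuatAlg K) (i : Fin 36) :
    trace K (a * (path K (some (dualPos i)) - path K (dualNeg i))) = coords K a i := by
  induction a using induction_on_path with
  | zero => simp
  | add a₁ a₂ h₁ h₂ => simp only [add_mul, map_add, h₁, h₂, Finsupp.add_apply]
  | smul_path r j =>
    rw [smul_mul_assoc, mul_sub, path_mul_path, path_mul_path, map_smul, map_sub, trace_path,
      trace_path, ← Int.cast_sub, pathTrace_wordAct_dual, map_smul, coords_path]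
    simp [coordVec, Finsupp.single_apply]

theorem eq_zero_of_trace_mul_eq_zero {a : QuatAlg K} (h : ∀ c, trace K (a * c) = 0) : a = 0 := by
  have hc : coords K a = 0 := Finsupp.ext fun i => by rw [← trace_mul_dual, h]; rfl
  rw [← ofCoords_coords K a, hc, map_zero]

end Basis

end QuatAlg

/-- Over any field `K` of characteristic two, the algebra `A = Q(3A)₂²` of
quaternion type is a symmetric algebra: there is a `K`-linear form `l : A → K` with
`l (a * b) = l (b * a)` for all `a, b ∈ A` whose kernel contains no nonzero right ideal
(right ideals of `A` being the `Aᵐᵒᵖ`-submodules of `A`). -/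
theorem quatAlg_isSymmetricAlgebra (K : Type u) [Field K] [CharP K 2] :
    ∃ l : QuatAlg K →ₗ[K] K,
      (∀ a b : QuatAlg K, l (a * b) = l (b * a)) ∧
      ∀ I : Submodule (QuatAlg K)ᵐᵒᵖ (QuatAlg K), (∀ x ∈ I, l x = 0) → I = ⊥ := by
  refine ⟨QuatAlg.trace K, QuatAlg.trace_mul_comm K, fun I hI => (Submodule.eq_bot_iff I).2 ?_⟩
  intro x hx
  refine QuatAlg.eq_zero_of_trace_mul_eq_zero K fun c => hI _ ?_
  exact I.smul_mem (MulOpposite.op c) hx
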